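/- arXiv:2509.06207 — 5 statements merged into one kernel-verified Lean document; each statement's English description precedes it below -/
import Mathlib

section
/- Let n and k be positive integers. For n ≥ 2k, the family ℬ_n(K_{k,k}) of all subgraphs of the complete bipartite graph K_{n,n} isomorphic to K_{k,k} (equivalently, for each k-subset A of one side and k-subset B of the other side, the complete bipartite graph with parts A and B) is an EKR family, and for n > 2k it is a strong EKR family. -/
/-- A family of finite sets is *intersecting* if any two of its members share an element. -/
def IsIntersectingFamily {α : Type*} (ℬ : Set (Finset α)) : Prop :=
  ∀ A ∈ ℬ, ∀ B ∈ ℬ, ∃ x, x ∈ A ∧ x ∈ B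

/-- The subfamily of all members of `𝒜` that contain `x`. -/
def famAt {α : Type*} (𝒜 : Set (Finset α)) (x : α) : Set (Finset α) :=
  {A ∈ 𝒜 | x ∈ A}

/-- `𝒜` is an *EKR family* over the ground set `X`: for every `x ∈ X`, the subfamily
`famAt 𝒜 x` has maximum cardinality among all intersecting subfamilies of `𝒜`. -/
def IsEKRFamily {α : Type*} (X : Set α) (𝒜 : Set (Finset α)) : Prop :=
  ∀ x ∈ X, ∀ ℬ ⊆ 𝒜, IsIntersectingFamily ℬ → ℬ.ncard ≤ (famAt 𝒜 x).ncard

/-- `𝒜` is a *strong EKR family* over the ground set `X`: it is an EKR family and moreover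
every intersecting subfamily of maximum cardinality equals `famAt 𝒜 x` for some `x ∈ X`. -/
def IsStrongEKRFamily {α : Type*} (X : Set α) (𝒜 : Set (Finset α)) : Prop :=
  IsEKRFamily X 𝒜 ∧ ∀ ℬ ⊆ 𝒜, IsIntersectingFamily ℬ →
    (∀ 𝒞 ⊆ 𝒜, IsIntersectingFamily 𝒞 → 𝒞.ncard ≤ ℬ.ncard) → ∃ x ∈ X, ℬ = famAt 𝒜 x

/-- The family of all subgraphs of `K_{n,n}` isomorphic to `K_{k,k}`: for each `k`-subset `A`
of the left side and `k`-subset `B` of the right side, the complete bipartite graph with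
parts `A` and `B`, identified with its edge set. -/
def kkFamily (n k : ℕ) : Set (Finset (Sym2 (Fin n ⊕ Fin n))) :=
  {E | ∃ A B : Finset (Fin n), A.card = k ∧ B.card = k ∧
      E = (A ×ˢ B).image fun p => s(Sum.inl p.1, Sum.inr p.2)}

/-- Cyclic interval condition: `j` is in the arc of length `k` starting at `i` on an `n`-cycle. -/
def cyc (n k i j : ℕ) : Prop := (i ≤ j ∧ j < i + k) ∨ (j + n < i + k)

instance (n k i j : ℕ) : Decidable (cyc n k i j) := by unfold cyc; infer_instance

/-- The arc. -/
def arc (n k : ℕ) (i : Fin n) : Finset (Fin n) := Finset.univ.filter fun j => cyc n k i j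

theorem mem_arc {n k : ℕ} {i j : Fin n} : j ∈ arc n k i ↔ cyc n k i j := by
  simp [arc]

theorem card_arc {n k : ℕ} (hkn : k ≤ n) (i : Fin n) : (arc n k i).card = k := by
  have h : (arc n k i).card = (Finset.range k).card := by
    refine Finset.card_bij (fun j _ => if i.val ≤ j.val then j.val - i.val else j.val + n - i.val)
      ?_ ?_ ?_
    · intro j hj
      rw [mem_arc, cyc] at hj
      have := i.2
      have := j.2
      rw [Finset.mem_range]
      split_ifs <;> omega
    · intro a ha b hb hab
      have := i.2
      have := a.2
      have := b.2
      apply Fin.ext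
      split_ifs at hab <;> omega
    · intro b hb
      rw [Finset.mem_range] at hb
      have := i.2
      by_cases h : i.val + b < n
      · refine ⟨⟨i.val + b, h⟩, ?_, ?_⟩
        · rw [mem_arc, cyc]; simp only; omega
        · simp
      · refine ⟨⟨i.val + b - n, by omega⟩, ?_, ?_⟩
        · rw [mem_arc, cyc]; simp only; omega
        · simp only; split_ifs <;> omega
  simpa using h

/-- Katona's lemma on natural-number positions. -/
theorem katona_nat {n k : ℕ} (hk : 0 < k) (hn : 2 * k ≤ n) (D : Finset ℕ)
    (h0 : 0 ∈ D) (hlt : ∀ u ∈ D, u < n)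
    (hD : ∀ u ∈ D, ∀ v ∈ D, u < v → v - u < k ∨ n - (v - u) < k) :
    D.card ≤ k ∧ (D.card = k → 2 * k < n →
      ∃ p < k, ∀ u < n, u ∈ D ↔ (u ≤ p ∨ n - k + p < u)) := by
  have hz : ∀ u ∈ D, u < k ∨ n - k < u := by
    intro u hu
    have := hlt u hu
    rcases Nat.eq_zero_or_pos u with h | h
    · omega
    · have := hD 0 h0 u hu h
      omega
  let f : ℕ → ℕ := fun u => if u < k then u else u - (n - k)
  have hinj : Set.InjOn f D := by
    intro u hu v hv huv
    have h1 := hz u hu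
    have h2 := hz v hv
    have h3 := hlt u hu
    have h4 := hlt v hv
    have h5 := hD u hu v hv
    have h6 := hD v hv u hu
    dsimp only [f] at huv
    split_ifs at huv <;> omega
  have hsub : D.image f ⊆ Finset.range k := by
    intro w hw
    obtain ⟨u, hu, rfl⟩ := Finset.mem_image.1 hw
    have h1 := hz u hu
    have h3 := hlt u hu
    rw [Finset.mem_range]
    dsimp only [f]
    split_ifs <;> omega
  have hc : (D.image f).card = D.card := Finset.card_image_of_injOn hinj
  refine ⟨?_, ?_⟩
  · have := Finset.card_le_card hsub
    rw [hc] at this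
    simpa using this
  intro hcard hnk
  have heq : D.image f = Finset.range k := by
    apply Finset.eq_of_subset_of_card_le hsub
    rw [hc, hcard]; simp
  have hor : ∀ u < k, u ∈ D ∨ u + (n - k) ∈ D := by
    intro u hu
    have : u ∈ D.image f := by rw [heq]; simpa using hu
    obtain ⟨v, hv, hvu⟩ := Finset.mem_image.1 this
    have h1 := hz v hv
    dsimp only [f] at hvu
    split_ifs at hvu with h
    · left; rw [← hvu]; exact hv
    · right
      have : u + (n - k) = v := by omega
      rw [this]; exact hv
  have hdown : ∀ u, u + 1 < k → u + 1 ∈ D → u ∈ D := by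
    intro u hu hu1
    rcases hor u (by omega) with h | h
    · exact h
    · have := hD _ hu1 _ h
      omega
  let E := D.filter (· < k)
  have hE : E.Nonempty := ⟨0, by simp [E, h0, hk]⟩
  have hp := E.max'_mem hE
  have hmax : ∀ u ∈ D, u < k → u ≤ E.max' hE := fun u hu h =>
    Finset.le_max' _ _ (by simp [E, hu, h])
  generalize E.max' hE = p at hp hmax
  simp only [E, Finset.mem_filter] at hp
  have hall : ∀ t, t ≤ p → p - t ∈ D := by
    intro t
    induction t with
    | zero => intro _; exact hp.1
    | succ t ih =>
      intro ht
      apply hdown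
      · omega
      · have := ih (by omega)
        have e : p - (t + 1) + 1 = p - t := by omega
        rw [e]; exact this
  refine ⟨p, hp.2, fun u hu => ⟨fun h => ?_, fun h => ?_⟩⟩
  · by_contra hcon
    rcases hz u h with h1 | h1
    · have := hmax u h h1
      omega
    · have h2 : u - (n - k) ∈ D := by
        have := hall (p - (u - (n - k))) (by omega)
        have e : p - (p - (u - (n - k))) = u - (n - k) := by omega
        rwa [e] at this
      have := hD _ h2 _ h
      omega
  · rcases h with h | h
    · have := hall (p - u) (by omega)
      have e : p - (p - u) = u := by omega
      rwa [e] at this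
    · rcases hor (u - (n - k)) (by omega) with h1 | h1
      · have := hmax _ h1 (by omega)
        omega
      · have e : u - (n - k) + (n - k) = u := by omega
        rwa [e] at h1

/-- Katona's lemma on the cycle, with the case of equality. -/
theorem katona_fin {n k : ℕ} (hk : 0 < k) (hn : 2 * k ≤ n) (S : Finset (Fin n))
    (hS : ∀ i ∈ S, ∀ j ∈ S, ∃ x, x ∈ arc n k i ∧ x ∈ arc n k j) :
    S.card ≤ k ∧ (S.card = k → 2 * k < n →
      ∃ c : Fin n, ∀ i, i ∈ S ↔ cyc n k i c) := by
  rcases S.eq_empty_or_nonempty with rfl | ⟨s, hs⟩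
  · refine ⟨by simp, fun h => ?_⟩
    simp at h
    omega
  let g : Fin n → ℕ := fun j => if s.val ≤ j.val then j.val - s.val else j.val + n - s.val
  have hg : ∀ j, g j = if s.val ≤ j.val then j.val - s.val else j.val + n - s.val := fun j => rfl
  have hginj : Function.Injective g := by
    intro a b hab
    have := s.2
    have := a.2
    have := b.2
    apply Fin.ext
    rw [hg, hg] at hab
    split_ifs at hab <;> omega
  have key := katona_nat hk hn (S.image g) (Finset.mem_image.2 ⟨s, hs, by simp [hg]⟩) (by
      intro u hu
      obtain ⟨j, hj, rfl⟩ := Finset.mem_image.1 hu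
      have := s.2
      have := j.2
      rw [hg]
      split_ifs <;> omega) (by
      intro u hu v hv huv
      obtain ⟨i, hi, rfl⟩ := Finset.mem_image.1 hu
      obtain ⟨j, hj, rfl⟩ := Finset.mem_image.1 hv
      obtain ⟨x, hx, hy⟩ := hS i hi j hj
      rw [mem_arc, cyc] at hx hy
      have := s.2
      have := i.2
      have := j.2
      have := x.2
      rw [hg, hg] at huv ⊢
      split_ifs at huv ⊢ <;> omega)
  rw [Finset.card_image_of_injective _ hginj] at key
  refine ⟨key.1, fun h1 h2 => ?_⟩
  obtain ⟨p, hp, hpp⟩ := key.2 h1 h2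
  have hs2 := s.2
  have hmem : ∀ i, i ∈ S ↔ (g i ≤ p ∨ n - k + p < g i) := by
    intro i
    rw [← hpp (g i) (by
      have := i.2
      rw [hg]
      split_ifs <;> omega)]
    rw [Finset.mem_image]
    constructor
    · intro h; exact ⟨i, h, rfl⟩
    · rintro ⟨j, hj, hji⟩
      rwa [← hginj hji]
  by_cases hsp : s.val + p < n
  · refine ⟨⟨s.val + p, hsp⟩, fun i => ?_⟩
    rw [hmem, cyc, hg]
    have := i.2
    simp only
    split_ifs <;> omega
  · refine ⟨⟨s.val + p - n, by omega⟩, fun i => ?_⟩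
    rw [hmem, cyc, hg]
    have := i.2
    simp only
    split_ifs <;> omega

/-- Some permutation carries `A` onto `B`. -/
theorem exists_perm_map {α : Type*} [Fintype α] [DecidableEq α] (A B : Finset α)
    (h : A.card = B.card) : ∃ σ : Equiv.Perm α, A.map σ.toEmbedding = B := by
  have e : {x // x ∈ A} ≃ {x // x ∈ B} := Finset.equivOfCardEq h
  refine ⟨e.extendSubtype, ?_⟩
  apply Finset.eq_of_subset_of_card_le
  · intro x hx
    obtain ⟨a, ha, rfl⟩ := Finset.mem_map.1 hx
    exact e.extendSubtype_mem a ha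
  · simp [h]

/-- Number of permutations carrying `A` onto `B`. -/
theorem count_perm {n k : ℕ} (A B : Finset (Fin n)) (hA : A.card = k) (hB : B.card = k) :
    (Finset.univ.filter fun σ : Equiv.Perm (Fin n) => A.map σ.toEmbedding = B).card
      * n.choose k = n.factorial := by
  have hind : ∀ C ∈ Finset.powersetCard k (Finset.univ : Finset (Fin n)),
      (Finset.univ.filter fun σ : Equiv.Perm (Fin n) => A.map σ.toEmbedding = C).card =
      (Finset.univ.filter fun σ : Equiv.Perm (Fin n) => A.map σ.toEmbedding = B).card := by
    intro C hC
    rw [Finset.mem_powersetCard] at hC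
    obtain ⟨τ, hτ⟩ := exists_perm_map C B (by rw [hC.2, hB])
    refine Finset.card_bij (fun σ _ => σ.trans τ) ?_ ?_ ?_
    · intro σ hσ
      simp only [Finset.mem_filter, Finset.mem_univ, true_and] at hσ ⊢
      rw [← hτ, ← hσ, Finset.map_map]
      rfl
    · intro a _ b _ hab
      ext x
      have := congrArg (fun e : Equiv.Perm (Fin n) => e x) hab
      simp only [Equiv.trans_apply, EmbeddingLike.apply_eq_iff_eq] at this
      rw [this]
    · intro σ hσ
      simp only [Finset.mem_filter, Finset.mem_univ, true_and] at hσ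
      refine ⟨σ.trans τ.symm, ?_, ?_⟩
      · simp only [Finset.mem_filter, Finset.mem_univ, true_and]
        apply Finset.map_injective τ.toEmbedding
        rw [hτ, ← hσ, Finset.map_map]
        congr 1
        ext x
        simp
      · ext x; simp
  have hsum := Finset.card_eq_sum_card_fiberwise (s := (Finset.univ : Finset (Equiv.Perm (Fin n))))
    (t := Finset.powersetCard k (Finset.univ : Finset (Fin n)))
    (f := fun σ => A.map σ.toEmbedding) (by
      intro σ _
      simp [hA])
  rw [Finset.sum_congr rfl hind, Finset.sum_const, Finset.card_powersetCard] at hsum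
  simp only [Finset.card_univ, Fintype.card_perm, Fintype.card_fin, smul_eq_mul] at hsum
  rw [hsum]; ring

/-- In the extremal case, on every cyclic order the arcs in `F` form a star. -/
theorem katona_center {n k : ℕ} (hk : 0 < k) (hn : 2 * k < n) (F : Finset (Finset (Fin n)))
    (hsz : ∀ A ∈ F, A.card = k) (hint : ∀ A ∈ F, ∀ B ∈ F, ∃ x, x ∈ A ∧ x ∈ B)
    (hcard : F.card = (n - 1).choose (k - 1)) (σ : Equiv.Perm (Fin n)) :
    ∃ c : Fin n, ∀ i, (arc n k i).map σ.toEmbedding ∈ F ↔ cyc n k i c := by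
  classical
  let S : Equiv.Perm (Fin n) → Finset (Fin n) := fun σ =>
    Finset.univ.filter fun i => (arc n k i).map σ.toEmbedding ∈ F
  have hS : ∀ σ, (S σ).card ≤ k ∧ ((S σ).card = k → 2 * k < n →
      ∃ c : Fin n, ∀ i, i ∈ S σ ↔ cyc n k i c) := by
    intro σ
    refine katona_fin hk hn.le _ fun i hi j hj => ?_
    simp only [S, Finset.mem_filter, Finset.mem_univ, true_and] at hi hj
    obtain ⟨x, hx, hy⟩ := hint _ hi _ hj
    refine ⟨σ.symm x, ?_, ?_⟩
    · simpa [Finset.mem_map_equiv] using hx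
    · simpa [Finset.mem_map_equiv] using hy
  have hdc : ∑ σ : Equiv.Perm (Fin n), (S σ).card = ∑ i : Fin n,
      (Finset.univ.filter fun σ : Equiv.Perm (Fin n) =>
        (arc n k i).map σ.toEmbedding ∈ F).card :=
    Finset.sum_card_bipartiteAbove_eq_sum_card_bipartiteBelow
      (fun (σ : Equiv.Perm (Fin n)) (i : Fin n) => (arc n k i).map σ.toEmbedding ∈ F)
  have hi : ∀ i : Fin n, (Finset.univ.filter fun σ : Equiv.Perm (Fin n) =>
        (arc n k i).map σ.toEmbedding ∈ F).card * n.choose k = F.card * n.factorial := by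
    intro i
    have h := Finset.card_eq_sum_card_fiberwise
      (s := Finset.univ.filter fun σ : Equiv.Perm (Fin n) =>
        (arc n k i).map σ.toEmbedding ∈ F)
      (t := F) (f := fun σ => (arc n k i).map σ.toEmbedding) (by
        intro σ hσ
        simpa using hσ)
    rw [h, Finset.sum_mul, ← smul_eq_mul, ← Finset.sum_const]
    refine Finset.sum_congr rfl fun B hB => ?_
    rw [← count_perm (arc n k i) B (card_arc (by omega) i) (hsz B hB)]
    congr 2
    ext σ
    simp only [Finset.mem_filter, Finset.mem_univ, true_and]
    constructor
    · exact fun h => h.2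
    · exact fun h => ⟨h ▸ hB, h⟩
  have hpos : 0 < n.choose k := Nat.choose_pos (by omega)
  have hch : n * (n - 1).choose (k - 1) = n.choose k * k := by
    have := Nat.add_one_mul_choose_eq (n - 1) (k - 1)
    rwa [Nat.sub_add_cancel (by omega), Nat.sub_add_cancel hk] at this
  have htot : ∑ σ : Equiv.Perm (Fin n), (S σ).card = ∑ σ : Equiv.Perm (Fin n), k := by
    apply Nat.eq_of_mul_eq_mul_right hpos
    rw [hdc, Finset.sum_mul, Finset.sum_congr rfl fun i _ => hi i]
    simp only [Finset.sum_const, Finset.card_univ, Fintype.card_perm, Fintype.card_fin,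
      smul_eq_mul]
    rw [hcard, ← mul_assoc, hch]; ring
  have hall := (Finset.sum_eq_sum_iff_of_le (fun σ _ => (hS σ).1)).1 htot
  obtain ⟨c, hc⟩ := (hS σ).2 (hall σ (Finset.mem_univ _)) hn
  refine ⟨c, fun i => ?_⟩
  rw [← hc]
  simp [S]

theorem swap_step_arith {n k : ℕ} (hk : 0 < k) (hn : 2 * k < n) (b c : ℕ) (hb : 2 ≤ b) (hbn : b < n)
    (hc : c < n) (h : ∀ i < n, i ≠ b → (i + k ≠ b ∧ i + k ≠ b + n) →
      (cyc n k i c ↔ cyc n k i 0)) : c = 0 := by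
  have h0 := h 0 (by omega)
  have h1 := h 1 (by omega)
  have h2 := h (n + 1 - k)
  have h3 := h (n - k) (by omega)
  unfold cyc at *
  rcases Nat.lt_or_ge 1 k with hk1 | hk1
  · have h2 := h2 (by omega)
    by_cases e1 : b = k
    · have a2 := h2 (by omega) (by omega)
      have a3 := h3 (by omega) (by omega)
      omega
    · by_cases e2 : b = k + 1
      · have a2 := h2 (by omega) (by omega)
        have a0 := h0 (by omega) (by omega)
        omega
      · have a0 := h0 (by omega) (by omega)
        have a1 := h1 (by omega) (by omega)
        omega
  · have a0 := h0 (by omega) (by omega)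
    omega

/-- Adjacent transpositions avoiding `0` preserve the centre `0`. -/
theorem swap_step {m k : ℕ} (hk : 0 < k) (hn : 2 * k < m + 2) (F : Finset (Finset (Fin (m + 2))))
    (hP : ∀ σ : Equiv.Perm (Fin (m + 2)), ∃ c : Fin (m + 2),
      ∀ i, (arc (m + 2) k i).map σ.toEmbedding ∈ F ↔ cyc (m + 2) k i c)
    (σ : Equiv.Perm (Fin (m + 2)))
    (hσ : ∀ i : Fin (m + 2), (arc (m + 2) k i).map σ.toEmbedding ∈ F ↔ cyc (m + 2) k i 0)
    (u v : Fin (m + 2)) (hu : 1 ≤ u.val) (huv : v.val = u.val + 1) :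
    ∀ i : Fin (m + 2), (arc (m + 2) k i).map (σ * Equiv.swap u v).toEmbedding ∈ F ↔
      cyc (m + 2) k i 0 := by
  obtain ⟨c, hc⟩ := hP (σ * Equiv.swap u v)
  have hc0 : c.val = 0 := by
    have hv := v.2
    refine swap_step_arith hk hn v.val c.val (by omega) v.2 c.2 ?_
    intro i hi h1 h2
    have e1 := hc ⟨i, hi⟩
    have e2 := hσ ⟨i, hi⟩
    have e3 : (arc (m + 2) k ⟨i, hi⟩).map (σ * Equiv.swap u v).toEmbedding
        = (arc (m + 2) k ⟨i, hi⟩).map σ.toEmbedding := by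
      ext x
      rw [Finset.mem_map_equiv, Finset.mem_map_equiv, mem_arc, mem_arc]
      have : (σ * Equiv.swap u v).symm x = Equiv.swap u v (σ.symm x) := by
        rw [Equiv.symm_apply_eq]; simp
      rw [this]
      generalize σ.symm x = y
      by_cases hy1 : y = u
      · rw [hy1, Equiv.swap_apply_left]
        simp only [cyc]
        omega
      · by_cases hy2 : y = v
        · rw [hy2, Equiv.swap_apply_right]
          simp only [cyc]
          omega
        · rw [Equiv.swap_apply_of_ne_of_ne hy1 hy2]
    rw [e3] at e1
    exact e1.symm.trans e2
  intro i
  rw [hc, hc0]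

theorem perm_step {m k : ℕ} (hk : 0 < k) (hn : 2 * k < m + 2) (F : Finset (Finset (Fin (m + 2))))
    (hP : ∀ σ : Equiv.Perm (Fin (m + 2)), ∃ c : Fin (m + 2),
      ∀ i, (arc (m + 2) k i).map σ.toEmbedding ∈ F ↔ cyc (m + 2) k i c)
    (e : Equiv.Perm (Fin (m + 1))) :
    ∀ σ : Equiv.Perm (Fin (m + 2)),
    (∀ i : Fin (m + 2), (arc (m + 2) k i).map σ.toEmbedding ∈ F ↔ cyc (m + 2) k i 0) →
    ∀ i : Fin (m + 2),
      (arc (m + 2) k i).map (σ * Equiv.Perm.decomposeFin.symm (0, e)).toEmbedding ∈ F ↔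
      cyc (m + 2) k i 0 := by
  have he : e ∈ Submonoid.closure (Set.range fun i : Fin m ↦ Equiv.swap i.castSucc i.succ) := by
    rw [Equiv.Perm.mclosure_swap_castSucc_succ]; trivial
  induction he using Submonoid.closure_induction with
  | mem x hx =>
    obtain ⟨i, rfl⟩ := hx
    intro σ hσ
    have : Equiv.Perm.decomposeFin.symm ((0 : Fin (m + 2)), Equiv.swap i.castSucc i.succ)
        = Equiv.swap i.castSucc.succ i.succ.succ := by
      ext x
      refine Fin.cases ?_ (fun y => ?_) x
      · rw [Equiv.Perm.decomposeFin_symm_apply_zero, Equiv.swap_apply_of_ne_of_ne]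
        · exact (Fin.succ_ne_zero _).symm
        · exact (Fin.succ_ne_zero _).symm
      · rw [Equiv.Perm.decomposeFin_symm_apply_succ]
        simp only [Equiv.swap_self, Equiv.refl_apply]
        simp only [Equiv.swap_apply_def, Fin.succ_inj]
        split_ifs <;> rfl
    simp only [this]
    exact swap_step hk hn F hP σ hσ _ _ (by simp) (by simp)
  | one =>
    intro σ hσ
    rw [Equiv.Perm.decomposeFin_symm_of_one, Equiv.swap_self]
    exact hσ
  | mul x y _ _ hx hy =>
    intro σ hσ
    have : Equiv.Perm.decomposeFin.symm ((0 : Fin (m + 2)), x * y)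
        = Equiv.Perm.decomposeFin.symm (0, x) * Equiv.Perm.decomposeFin.symm (0, y) := by
      ext z
      refine Fin.cases ?_ (fun y => ?_) z
      · simp
      · simp [Equiv.Perm.decomposeFin_symm_apply_succ]
    rw [this, ← mul_assoc]
    exact hy _ (hx _ hσ)

theorem card_star {n k : ℕ} (hk : 0 < k) (x : Fin n) :
    ((Finset.powersetCard k (Finset.univ : Finset (Fin n))).filter (x ∈ ·)).card
      = (n - 1).choose (k - 1) := by
  have : ((Finset.powersetCard k (Finset.univ : Finset (Fin n))).filter (x ∈ ·)) =
      (Finset.powersetCard (k - 1) (Finset.univ.erase x)).image (insert x) := by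
    ext A
    simp only [Finset.mem_filter, Finset.mem_powersetCard, Finset.mem_image]
    constructor
    · rintro ⟨⟨_, hA⟩, hx⟩
      refine ⟨A.erase x, ⟨Finset.erase_subset_erase _ (Finset.subset_univ _), ?_⟩,
        Finset.insert_erase hx⟩
      rw [Finset.card_erase_of_mem hx, hA]
    · rintro ⟨B, ⟨hB, hc⟩, rfl⟩
      have : x ∉ B := fun h => by simpa using hB h
      refine ⟨⟨Finset.subset_univ _, ?_⟩, Finset.mem_insert_self _ _⟩
      rw [Finset.card_insert_of_notMem this, hc]
      omega
  rw [this, Finset.card_image_of_injOn, Finset.card_powersetCard]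
  · simp
  · intro A hA B hB hAB
    simp only [Finset.mem_coe, Finset.mem_powersetCard] at hA hB
    have h1 : x ∉ A := fun h => by simpa using hA.1 h
    have h2 : x ∉ B := fun h => by simpa using hB.1 h
    rw [← Finset.erase_insert h1, ← Finset.erase_insert h2]
    exact congrArg (fun C => C.erase x) hAB

/-- Uniqueness in the Erdős–Ko–Rado theorem. -/
theorem ekr_unique {n k : ℕ} (hk : 0 < k) (hn : 2 * k < n) (F : Finset (Finset (Fin n)))
    (hsz : ∀ A ∈ F, A.card = k) (hint : ∀ A ∈ F, ∀ B ∈ F, ∃ x, x ∈ A ∧ x ∈ B)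
    (hcard : F.card = (n - 1).choose (k - 1)) :
    ∃ x, F = (Finset.powersetCard k (Finset.univ : Finset (Fin n))).filter (x ∈ ·) := by
  have hP := katona_center hk hn F hsz hint hcard
  obtain ⟨m, rfl⟩ : ∃ m, n = m + 2 := ⟨n - 2, by omega⟩
  obtain ⟨c, hc⟩ := hP 1
  have hT : ∀ i : Fin (m + 2), (arc (m + 2) k i).map (Equiv.addRight c).toEmbedding ∈ F ↔
      cyc (m + 2) k i 0 := by
    intro i
    have e : (arc (m + 2) k i).map (Equiv.addRight c).toEmbedding
        = (arc (m + 2) k (i + c)).map (1 : Equiv.Perm (Fin (m + 2))).toEmbedding := by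
      ext y
      rw [Finset.mem_map_equiv, Finset.mem_map_equiv, mem_arc, mem_arc]
      obtain ⟨z, rfl⟩ : ∃ z, y = z + c := ⟨y - c, by simp⟩
      have : (Equiv.addRight c).symm (z + c) = z := by simp
      rw [this]
      have : (Equiv.symm (1 : Equiv.Perm (Fin (m + 2)))) (z + c) = z + c := rfl
      rw [this]
      have := z.2
      have := i.2
      have := c.2
      simp only [cyc, Fin.val_add_eq_ite]
      split_ifs <;> omega
    rw [e, hc]
    have := i.2
    have := c.2
    simp only [cyc, Fin.val_add_eq_ite]
    split_ifs <;> omega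
  generalize Equiv.addRight c = σ at hT
  refine ⟨σ 0, (Finset.eq_of_subset_of_card_le ?_ ?_).symm⟩
  · intro B hB
    simp only [Finset.mem_filter, Finset.mem_powersetCard] at hB
    obtain ⟨⟨_, hBk⟩, hxB⟩ := hB
    let C := B.map σ.symm.toEmbedding
    have hC0 : (0 : Fin (m + 2)) ∈ C := by
      simp only [C, Finset.mem_map_equiv]; simpa using hxB
    obtain ⟨ρ, hρ⟩ := exists_perm_map (arc (m + 2) k 0) C (by
      rw [card_arc (by omega)]; simp [C, hBk])
    have h00 : (0 : Fin (m + 2)) ∈ arc (m + 2) k 0 := by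
      rw [mem_arc, cyc]; simp; omega
    have hρ0 : ρ 0 ∈ C := by
      rw [← hρ]; exact Finset.mem_map_of_mem ρ.toEmbedding h00
    let τ : Equiv.Perm (Fin (m + 2)) := Equiv.swap (ρ 0) 0 * ρ
    have hτ0 : τ 0 = 0 := by simp [τ]
    have hτ : ∀ y ∈ arc (m + 2) k 0, σ (τ y) ∈ B := by
      intro y hy
      have h1 : ρ y ∈ C := by
        rw [← hρ]; exact Finset.mem_map_of_mem ρ.toEmbedding hy
      have h2 : τ y ∈ C := by
        simp only [τ, Equiv.Perm.mul_apply, Equiv.swap_apply_def]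
        split_ifs <;> assumption
      simpa [C, Finset.mem_map_equiv] using h2
    obtain ⟨⟨p, e⟩, he⟩ := Equiv.Perm.decomposeFin.symm.surjective τ
    have hp : p = 0 := by
      rw [← hτ0, ← he, Equiv.Perm.decomposeFin_symm_apply_zero]
    subst hp
    have h := (perm_step hk hn F hP e σ hT 0).2 (by simp [cyc]; omega)
    rw [he] at h
    have : (arc (m + 2) k 0).map (σ * τ).toEmbedding = B := by
      apply Finset.eq_of_subset_of_card_le
      · intro z hz
        obtain ⟨y, hy, rfl⟩ := Finset.mem_map.1 hz
        exact hτ y hy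
      · rw [Finset.card_map, card_arc (by omega), hBk]
    rwa [this] at h
  · rw [card_star hk, hcard]

/-- The edge set of the complete bipartite graph with parts `A`, `B`. -/
def kkEdges {n : ℕ} (p : Finset (Fin n) × Finset (Fin n)) : Finset (Sym2 (Fin n ⊕ Fin n)) :=
  (p.1 ×ˢ p.2).image fun q => s(Sum.inl q.1, Sum.inr q.2)

theorem mem_kkEdges {n : ℕ} (p : Finset (Fin n) × Finset (Fin n)) (a b : Fin n) :
    s(Sum.inl a, Sum.inr b) ∈ kkEdges p ↔ a ∈ p.1 ∧ b ∈ p.2 := by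
  simp [kkEdges]

/-- Pairs of `k`-sets. -/
def kkPairs (n k : ℕ) : Finset (Finset (Fin n) × Finset (Fin n)) :=
  Finset.powersetCard k Finset.univ ×ˢ Finset.powersetCard k Finset.univ

theorem mem_kkPairs {n k : ℕ} (p : Finset (Fin n) × Finset (Fin n)) :
    p ∈ kkPairs n k ↔ p.1.card = k ∧ p.2.card = k := by
  simp [kkPairs, Finset.mem_product, Finset.mem_powersetCard]

theorem kkEdges_injOn {n k : ℕ} (hk : 0 < k) :
    Set.InjOn (kkEdges (n := n)) (kkPairs n k : Set (Finset (Fin n) × Finset (Fin n))) := by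
  intro p hp q hq h
  rw [Finset.mem_coe, mem_kkPairs] at hp hq
  have hm : ∀ a b, (a ∈ p.1 ∧ b ∈ p.2) ↔ (a ∈ q.1 ∧ b ∈ q.2) := by
    intro a b
    rw [← mem_kkEdges, ← mem_kkEdges, h]
  obtain ⟨a, ha⟩ := Finset.card_pos.1 (hp.1 ▸ hk)
  obtain ⟨b, hb⟩ := Finset.card_pos.1 (hp.2 ▸ hk)
  have h0 := (hm a b).1 ⟨ha, hb⟩
  refine Prod.ext ?_ ?_
  · ext x
    have := hm x b
    tauto
  · ext x
    have := hm a x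
    tauto

theorem mem_kkFamily {n k : ℕ} (E : Finset (Sym2 (Fin n ⊕ Fin n))) :
    E ∈ kkFamily n k ↔ ∃ p ∈ kkPairs n k, kkEdges p = E := by
  constructor
  · rintro ⟨A, B, hA, hB, rfl⟩
    exact ⟨(A, B), (mem_kkPairs _).2 ⟨hA, hB⟩, rfl⟩
  · rintro ⟨p, hp, rfl⟩
    rw [mem_kkPairs] at hp
    exact ⟨p.1, p.2, hp.1, hp.2, rfl⟩

theorem famAt_kk {n k : ℕ} (a b : Fin n) :
    famAt (kkFamily n k) s(Sum.inl a, Sum.inr b) =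
      kkEdges '' ((((Finset.powersetCard k (Finset.univ : Finset (Fin n))).filter (a ∈ ·)) ×ˢ
        ((Finset.powersetCard k (Finset.univ : Finset (Fin n))).filter (b ∈ ·)) :
        Finset (Finset (Fin n) × Finset (Fin n))) : Set (Finset (Fin n) × Finset (Fin n))) := by
  ext E
  constructor
  · rintro ⟨hE, hx⟩
    obtain ⟨p, hp, rfl⟩ := (mem_kkFamily E).1 hE
    rw [mem_kkEdges] at hx
    rw [mem_kkPairs] at hp
    exact ⟨p, by simp [hp, hx], rfl⟩
  · rintro ⟨p, hp, rfl⟩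
    simp only [Finset.coe_product, Set.mem_prod, Finset.mem_coe, Finset.mem_filter,
      Finset.mem_powersetCard] at hp
    refine ⟨(mem_kkFamily _).2 ⟨p, (mem_kkPairs p).2 ⟨hp.1.1.2, hp.2.1.2⟩, rfl⟩, ?_⟩
    exact (mem_kkEdges _ _ _).2 ⟨hp.1.2, hp.2.2⟩

theorem famAt_ncard {n k : ℕ} (hk : 0 < k) (a b : Fin n) :
    (famAt (kkFamily n k) s(Sum.inl a, Sum.inr b)).ncard =
      (n - 1).choose (k - 1) * (n - 1).choose (k - 1) := by
  rw [famAt_kk, Set.InjOn.ncard_image, Set.ncard_coe_finset, Finset.card_product,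
    card_star hk, card_star hk]
  refine (kkEdges_injOn hk).mono ?_
  intro p hp
  simp only [Finset.coe_product, Set.mem_prod, Finset.mem_coe, Finset.mem_filter,
      Finset.mem_powersetCard] at hp
  exact (mem_kkPairs p).2 ⟨hp.1.1.2, hp.2.1.2⟩

theorem edge_form {n : ℕ} (x : Sym2 (Fin n ⊕ Fin n))
    (hx : x ∈ (completeBipartiteGraph (Fin n) (Fin n)).edgeSet) :
    ∃ a b, x = s(Sum.inl a, Sum.inr b) := by
  induction x using Sym2.ind with
  | _ u v =>
    rw [SimpleGraph.mem_edgeSet, completeBipartiteGraph_adj] at hx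
    rcases u with u | u <;> rcases v with v | v <;> simp at hx
    · exact ⟨u, v, rfl⟩
    · exact ⟨v, u, Sym2.eq_swap⟩

/-- Structure of an intersecting subfamily. -/
theorem kk_struct {n k : ℕ} (hk : 0 < k) (hn : 2 * k ≤ n)
    (ℬ : Set (Finset (Sym2 (Fin n ⊕ Fin n)))) (hsub : ℬ ⊆ kkFamily n k)
    (hint : IsIntersectingFamily ℬ) :
    ∃ (P : Finset (Finset (Fin n) × Finset (Fin n))) (F G : Finset (Finset (Fin n))),
      ℬ = kkEdges '' (P : Set (Finset (Fin n) × Finset (Fin n))) ∧ ℬ.ncard = P.card ∧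
      P ⊆ F ×ˢ G ∧
      (∀ A ∈ F, A.card = k) ∧ (∀ A ∈ F, ∀ B ∈ F, ∃ x, x ∈ A ∧ x ∈ B) ∧
      (∀ A ∈ G, A.card = k) ∧ (∀ A ∈ G, ∀ B ∈ G, ∃ x, x ∈ A ∧ x ∈ B) ∧
      F.card ≤ (n - 1).choose (k - 1) ∧ G.card ≤ (n - 1).choose (k - 1) := by
  classical
  let P := (kkPairs n k).filter fun p => kkEdges p ∈ ℬ
  have hP : ∀ p, p ∈ P ↔ (p.1.card = k ∧ p.2.card = k) ∧ kkEdges p ∈ ℬ := by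
    intro p
    simp only [P, Finset.mem_filter, mem_kkPairs]
  have hℬ : ℬ = kkEdges '' (P : Set (Finset (Fin n) × Finset (Fin n))) := by
    ext E
    constructor
    · intro hE
      obtain ⟨p, hp, rfl⟩ := (mem_kkFamily E).1 (hsub hE)
      exact ⟨p, Finset.mem_filter.2 ⟨hp, hE⟩, rfl⟩
    · rintro ⟨p, hp, rfl⟩
      exact ((hP p).1 hp).2
  have hpq : ∀ p ∈ P, ∀ q ∈ P, (∃ x, x ∈ p.1 ∧ x ∈ q.1) ∧ (∃ x, x ∈ p.2 ∧ x ∈ q.2) := by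
    intro p hp q hq
    obtain ⟨x, hx, hy⟩ := hint _ ((hP p).1 hp).2 _ ((hP q).1 hq).2
    obtain ⟨⟨a, b⟩, hab, rfl⟩ := Finset.mem_image.1 hx
    have h1 := (mem_kkEdges p a b).1 hx
    have h2 := (mem_kkEdges q a b).1 hy
    exact ⟨⟨a, h1.1, h2.1⟩, ⟨b, h1.2, h2.2⟩⟩
  have ekr : ∀ F : Finset (Finset (Fin n)), (∀ A ∈ F, A.card = k) →
      (∀ A ∈ F, ∀ B ∈ F, ∃ x, x ∈ A ∧ x ∈ B) → F.card ≤ (n - 1).choose (k - 1) := by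
    intro F h1 h2
    refine Finset.erdos_ko_rado ?_ ?_ (by omega)
    · intro A hA B hB hd
      obtain ⟨x, hx, hy⟩ := h2 A hA B hB
      exact Finset.disjoint_left.1 hd hx hy
    · intro A hA
      exact h1 A hA
  have f1 : ∀ A ∈ P.image Prod.fst, A.card = k := by
    intro A hA
    obtain ⟨p, hp, rfl⟩ := Finset.mem_image.1 hA
    exact ((hP p).1 hp).1.1
  have g1 : ∀ A ∈ P.image Prod.snd, A.card = k := by
    intro A hA
    obtain ⟨p, hp, rfl⟩ := Finset.mem_image.1 hA
    exact ((hP p).1 hp).1.2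
  have f2 : ∀ A ∈ P.image Prod.fst, ∀ B ∈ P.image Prod.fst, ∃ x, x ∈ A ∧ x ∈ B := by
    intro A hA B hB
    obtain ⟨p, hp, rfl⟩ := Finset.mem_image.1 hA
    obtain ⟨q, hq, rfl⟩ := Finset.mem_image.1 hB
    exact (hpq p hp q hq).1
  have g2 : ∀ A ∈ P.image Prod.snd, ∀ B ∈ P.image Prod.snd, ∃ x, x ∈ A ∧ x ∈ B := by
    intro A hA B hB
    obtain ⟨p, hp, rfl⟩ := Finset.mem_image.1 hA
    obtain ⟨q, hq, rfl⟩ := Finset.mem_image.1 hB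
    exact (hpq p hp q hq).2
  refine ⟨P, P.image Prod.fst, P.image Prod.snd, hℬ, ?_, ?_, f1, f2, g1, g2,
    ekr _ f1 f2, ekr _ g1 g2⟩
  · rw [hℬ, Set.InjOn.ncard_image, Set.ncard_coe_finset]
    refine (kkEdges_injOn hk).mono ?_
    intro p hp
    exact (mem_kkPairs p).2 ((hP p).1 hp).1
  · intro p hp
    exact Finset.mem_product.2 ⟨Finset.mem_image_of_mem _ hp, Finset.mem_image_of_mem _ hp⟩

theorem kk_ekr {n k : ℕ} (hk : 0 < k) (hn : 2 * k ≤ n) :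
    IsEKRFamily (completeBipartiteGraph (Fin n) (Fin n)).edgeSet (kkFamily n k) := by
  intro x hx ℬ hsub hint
  obtain ⟨a, b, rfl⟩ := edge_form x hx
  obtain ⟨P, F, G, _, hc, hPFG, _, _, _, _, hF, hG⟩ := kk_struct hk hn ℬ hsub hint
  rw [famAt_ncard hk, hc]
  calc P.card ≤ (F ×ˢ G).card := Finset.card_le_card hPFG
    _ = F.card * G.card := Finset.card_product _ _
    _ ≤ _ := Nat.mul_le_mul hF hG

theorem kk_strong {n k : ℕ} (hk : 0 < k) (hn : 2 * k < n) :
    IsStrongEKRFamily (completeBipartiteGraph (Fin n) (Fin n)).edgeSet (kkFamily n k) := by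
  refine ⟨kk_ekr hk hn.le, ?_⟩
  intro ℬ hsub hint hmax
  obtain ⟨P, F, G, hℬ, hc, hPFG, f1, f2, g1, g2, hF, hG⟩ := kk_struct hk hn.le ℬ hsub hint
  have hge : (n - 1).choose (k - 1) * (n - 1).choose (k - 1) ≤ P.card := by
    have z : Fin n := ⟨0, by omega⟩
    rw [← hc, ← famAt_ncard hk z z]
    refine hmax _ (fun E hE => hE.1) ?_
    intro A hA B hB
    exact ⟨_, hA.2, hB.2⟩
  have hle : P.card ≤ F.card * G.card := by
    rw [← Finset.card_product]; exact Finset.card_le_card hPFG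
  have hpos : 0 < (n - 1).choose (k - 1) := Nat.choose_pos (by omega)
  have hFe : F.card = (n - 1).choose (k - 1) := by
    refine le_antisymm hF ?_
    by_contra hlt
    push Not at hlt
    have : F.card * G.card < (n - 1).choose (k - 1) * (n - 1).choose (k - 1) :=
      lt_of_le_of_lt (Nat.mul_le_mul_left _ hG) (Nat.mul_lt_mul_of_pos_right hlt hpos)
    omega
  have hGe : G.card = (n - 1).choose (k - 1) := by
    refine le_antisymm hG ?_
    by_contra hlt
    push Not at hlt
    have : F.card * G.card < (n - 1).choose (k - 1) * (n - 1).choose (k - 1) :=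
      lt_of_le_of_lt (Nat.mul_le_mul_right _ hF) (Nat.mul_lt_mul_of_pos_left hlt hpos)
    omega
  have hPe : P = F ×ˢ G := by
    apply Finset.eq_of_subset_of_card_le hPFG
    rw [Finset.card_product, hFe, hGe]; exact hge
  obtain ⟨a, ha⟩ := ekr_unique hk hn F f1 f2 hFe
  obtain ⟨b, hb⟩ := ekr_unique hk hn G g1 g2 hGe
  refine ⟨s(Sum.inl a, Sum.inr b), ?_, ?_⟩
  · rw [SimpleGraph.mem_edgeSet, completeBipartiteGraph_adj]
    simp
  · rw [famAt_kk, hℬ, hPe, ha, hb]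

/-- For positive integers `n, k` with `n ≥ 2k`, the family of all copies of `K_{k,k}` in
`K_{n,n}` is an EKR family, and for `n > 2k` it is a strong EKR family. -/
theorem kkFamily_EKR (n k : ℕ) (hk : 0 < k) (hn : 0 < n) :
    (2 * k ≤ n →
      IsEKRFamily (completeBipartiteGraph (Fin n) (Fin n)).edgeSet (kkFamily n k)) ∧
    (2 * k < n →
      IsStrongEKRFamily (completeBipartiteGraph (Fin n) (Fin n)).edgeSet (kkFamily n k)) := by
  exact ⟨fun h => kk_ekr hk h, fun h => kk_strong hk h⟩
end

section
/- Let m ≤ n be positive integers and let ℳ be an EKR family of m-subsets of an n-element set X. Then the maximum cardinality of an intersecting subfamily of ℳ equals (m/n)|ℳ|; that is, n times the maximum cardinality of an intersecting subfamily of ℳ equals m · |ℳ|. -/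
/-- If `ℳ` is an EKR family of `m`-subsets of an `n`-element set `X`, then the maximum
cardinality of an intersecting subfamily of `ℳ` equals `(m / n) * |ℳ|`; that is, `n` times the
cardinality of any intersecting subfamily of maximum cardinality equals `m * |ℳ|`. -/
theorem EKR_max_intersecting_card {α : Type*}
    (m n : ℕ) (hm : 0 < m) (hmn : m ≤ n)
    (X : Set α) (hXfin : X.Finite) (hXcard : X.ncard = n)
    (ℳ : Set (Finset α)) (hℳ : ∀ M ∈ ℳ, ↑M ⊆ X ∧ M.card = m)
    (hEKR : IsEKRFamily X ℳ) :
    ∀ ℬ ⊆ ℳ, IsIntersectingFamily ℬ →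
      (∀ 𝒞 ⊆ ℳ, IsIntersectingFamily 𝒞 → 𝒞.ncard ≤ ℬ.ncard) →
      n * ℬ.ncard = m * ℳ.ncard := by
  classical
  intro ℬ hℬ hint hmax
  lift X to Finset α using hXfin
  have hfin : ℳ.Finite := by
    refine (X.powerset.finite_toSet).subset ?_
    intro M hM
    simpa using (hℳ M hM).1
  lift ℳ to Finset (Finset α) using hfin
  have hdeg : ∀ x ∈ X, (ℳ.filter (fun M => x ∈ M)).card = ℬ.ncard := by
    intro x hx
    have h1 : famAt (↑ℳ) x = ↑(ℳ.filter (fun M => x ∈ M)) := by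
      ext A; simp [famAt]
    have h2 : (famAt (↑ℳ : Set (Finset α)) x).ncard ≤ ℬ.ncard :=
      hmax _ (fun A hA => hA.1) (fun A hA B hB => ⟨x, hA.2, hB.2⟩)
    have h3 := hEKR x (by simpa using hx) ℬ hℬ hint
    have h4 := le_antisymm h2 h3
    rwa [h1, Set.ncard_coe_finset] at h4
  rw [Set.ncard_coe_finset] at hXcard ⊢
  have key := Finset.sum_card_bipartiteAbove_eq_sum_card_bipartiteBelow
    (s := X) (t := ℳ) (fun x M => x ∈ M)
  have hl : ∑ x ∈ X, (ℳ.bipartiteAbove (fun x M => x ∈ M) x).card = n * ℬ.ncard := by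
    refine (Finset.sum_congr rfl (fun x hx => hdeg x hx)).trans ?_
    simp [hXcard]
  have hr : ∑ M ∈ ℳ, (X.bipartiteBelow (fun x M => x ∈ M) M).card = m * ℳ.card := by
    have : ∀ M ∈ ℳ, (X.bipartiteBelow (fun x M => x ∈ M) M).card = m := by
      intro M hM
      have h := hℳ M (by simpa using hM)
      rw [← h.2]
      congr 1
      ext y
      simp only [Finset.bipartiteBelow, Finset.mem_filter]
      exact ⟨fun h => h.2, fun hy => ⟨by simpa using h.1 hy, hy⟩⟩
    rw [Finset.sum_congr rfl this]
    simp [mul_comm]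
  rw [← hl, ← hr]
  exact key
end

section
/- Let ℓ ≤ m ≤ n be positive integers, X an n-element set, ℒ a family of ℓ-subsets of X, ℳ a family of m-subsets of X, and ∼_I a finite family of regular relations from ℒ to ℳ. If (ℒ, ℳ, ∼_I) is an EKR chain, then for every M ∈ ℳ and every i ∈ I, the maximum cardinality of an intersecting subfamily of ℒ_M^{(i)} equals (ℓ/m)|ℒ_M^{(i)}|; that is, m times the maximum cardinality of an intersecting subfamily of ℒ_M^{(i)} equals ℓ · |ℒ_M^{(i)}|. -/
/-- In an EKR chain `(ℒ, ℳ, ∼_I)`, for every `M ∈ ℳ` and `i ∈ I`, the maximum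
cardinality of an intersecting subfamily of `ℒ_M^{(i)}` equals `(ℓ / m) * |ℒ_M^{(i)}|`;
that is, `m` times that maximum cardinality equals `ℓ * |ℒ_M^{(i)}|`. -/
theorem EKRchain_max_intersecting_card {α : Type*} {I : Type*} [Fintype I]
    (ℓ m n : ℕ) (hℓ : 0 < ℓ) (hlm : ℓ ≤ m) (hmn : m ≤ n)
    (X : Set α) (hXfin : X.Finite) (hXcard : X.ncard = n)
    (ℒ ℳ : Set (Finset α))
    (hℒ : ∀ L ∈ ℒ, ↑L ⊆ X ∧ L.card = ℓ)
    (hℳ : ∀ M ∈ ℳ, ↑M ⊆ X ∧ M.card = m)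
    (r : I → Finset α → Finset α → Prop)
    -- each `r i` is a regular relation from `ℒ` to `ℳ`
    (hreg : ∀ i : I, ∀ L ∈ ℒ, ∀ M ∈ ℳ, r i L M → L ⊆ M)
    -- (i) `ℳ` is an EKR family
    (hM_EKR : IsEKRFamily X ℳ)
    -- (ii) each `ℒ_M^{(i)}` is an EKR family over the ground set `M`
    (hLM_EKR : ∀ M ∈ ℳ, ∀ i : I, IsEKRFamily (↑M) {L ∈ ℒ | r i L M})
    -- (iii) all the `ℒ_M^{(i)}` have the same, positive, cardinality
    (hLM_card : ∀ M ∈ ℳ, ∀ M' ∈ ℳ, ∀ i j : I,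
      {L ∈ ℒ | r i L M}.ncard = {L ∈ ℒ | r j L M'}.ncard)
    (hLM_pos : ∀ M ∈ ℳ, ∀ i : I, 0 < {L ∈ ℒ | r i L M}.ncard)
    -- (iv) the sums `∑ i |ℳ_L^{(i)}|` do not depend on `L ∈ ℒ`
    (hML_sum : ∀ L ∈ ℒ, ∀ L' ∈ ℒ,
      ∑ i : I, {M ∈ ℳ | r i L M}.ncard = ∑ i : I, {M ∈ ℳ | r i L' M}.ncard) :
    ∀ M ∈ ℳ, ∀ i : I, ∀ ℬ ⊆ {L ∈ ℒ | r i L M}, IsIntersectingFamily ℬ →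
      (∀ 𝒞 ⊆ {L ∈ ℒ | r i L M}, IsIntersectingFamily 𝒞 → 𝒞.ncard ≤ ℬ.ncard) →
      m * ℬ.ncard = ℓ * {L ∈ ℒ | r i L M}.ncard := by
  classical
  intro M hM i ℬ hℬ hint hmax
  have hfin : {L ∈ ℒ | r i L M}.Finite := Set.finite_of_ncard_pos (hLM_pos M hM i)
  have hx : ∀ x ∈ M, (famAt {L ∈ ℒ | r i L M} x).ncard = ℬ.ncard := by
    intro x hxM
    apply le_antisymm
    · exact hmax _ (fun A hA => hA.1) (fun A hA B hB => ⟨x, hA.2, hB.2⟩)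
    · exact hLM_EKR M hM i x hxM ℬ hℬ hint
  have hF : ∀ L ∈ hfin.toFinset, L ⊆ M ∧ L.card = ℓ := by
    intro L hL
    have hL' := hfin.mem_toFinset.1 hL
    exact ⟨hreg i L hL'.1 M hM hL'.2, (hℒ L hL'.1).2⟩
  have hx' : ∀ x ∈ M, (hfin.toFinset.filter (fun L => x ∈ L)).card = ℬ.ncard := by
    intro x hxM
    rw [← hx x hxM, ← Set.ncard_coe_finset]
    congr 1
    ext L
    simp [famAt]
  have hdc := Finset.sum_card_bipartiteAbove_eq_sum_card_bipartiteBelow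
    (s := M) (t := hfin.toFinset) (fun x L => x ∈ L)
  unfold Finset.bipartiteAbove Finset.bipartiteBelow at hdc
  rw [Finset.sum_congr rfl hx'] at hdc
  have h2 : ∀ L ∈ hfin.toFinset, (M.filter (fun x => x ∈ L)).card = ℓ := by
    intro L hL
    rw [Finset.filter_mem_eq_inter, Finset.inter_eq_right.2 (hF L hL).1, (hF L hL).2]
  rw [Finset.sum_congr rfl h2, Finset.sum_const, Finset.sum_const, (hℳ M hM).2, smul_eq_mul,
    smul_eq_mul, ← Set.ncard_eq_toFinset_card _ hfin] at hdc
  rw [hdc, mul_comm]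
end

section
/- Let X be an n-element set and 𝒱 a family of k-subsets of X with n ≥ 2k. Assume: (1) there is a group G acting transitively on X whose induced action on k-subsets (gA = {ga : a ∈ A}) preserves 𝒱 and is transitive on 𝒱; (2) there is a cyclic ordering x_0, x_1, …, x_{n−1} of the elements of X such that for every index i (taken modulo n) the set {x_i, x_{i+1}, …, x_{i+k−1}} of k consecutive elements belongs to 𝒱. Then 𝒱 is an EKR family. -/
lemma katona_aux {n k : ℕ} (hnk : 2 * k ≤ n) (I : Finset (ZMod n))
    (hI : ∀ i ∈ I, ∀ j ∈ I, ∃ s < k, ∃ t < k, i + (s : ZMod n) = j + (t : ZMod n)) :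
    I.card ≤ k := by
  classical
  rcases I.eq_empty_or_nonempty with rfl | ⟨i0, h0⟩
  · simp
  have key : ∀ j : ZMod n, ∃ d : ℕ, j ∈ I →
      (d < k ∧ (j = i0 + (d : ZMod n) ∨ j + (k : ZMod n) = i0 + (d : ZMod n))) := by
    intro j
    by_cases hj : j ∈ I
    · obtain ⟨s, hs, t, ht, h⟩ := hI i0 h0 j hj
      by_cases hst : t ≤ s
      · refine ⟨s - t, fun _ => ⟨by omega, Or.inl ?_⟩⟩
        rw [Nat.cast_sub hst]
        linear_combination -h
      · refine ⟨s + k - t, fun _ => ⟨by omega, Or.inr ?_⟩⟩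
        rw [Nat.cast_sub (by omega)]
        push_cast
        linear_combination -h
    · exact ⟨0, fun h => absurd h hj⟩
  have bad : ∀ j ∈ I, ∀ j' ∈ I, j ≠ j' + (k : ZMod n) := by
    intro j hj j' hj' e
    obtain ⟨s, hs, t, ht, h⟩ := hI j hj j' hj'
    have h2 : ((k + s : ℕ) : ZMod n) = (t : ZMod n) := by
      push_cast
      linear_combination h - e
    rw [ZMod.natCast_eq_natCast_iff'] at h2
    rw [Nat.mod_eq_of_lt (by omega), Nat.mod_eq_of_lt (by omega)] at h2
    omega
  choose f hf using key
  have := Finset.card_le_card_of_injOn (s := I) (t := Finset.range k) f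
    (fun j hj => by simpa using (hf j hj).1) (by
      intro j hj j' hj' e
      rcases (hf j hj).2 with h1 | h1 <;> rcases (hf j' hj').2 with h2 | h2
      · rw [h1, h2, e]
      · exact absurd (by rw [h1, h2, e]) (bad j hj j' hj')
      · exact absurd (by rw [h1, h2, e]) (bad j' hj' j hj)
      · rw [e, ← h2] at h1
        exact add_right_cancel h1)
  simpa using this

open scoped Pointwise in
lemma count_const {α H : Type*} [DecidableEq α] [Group H] [Fintype H] [MulAction H α]
    (V : Finset (Finset α)) (hcl : ∀ A ∈ V, ∀ g : H, g • A ∈ V)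
    (htr : ∀ A ∈ V, ∀ B ∈ V, ∃ g : H, g • A = B) (A₀ : Finset α) (hA₀ : A₀ ∈ V) :
    ∃ c : ℕ, 0 < c ∧ c * V.card = Fintype.card H ∧
      ∀ A ∈ V, ∀ B ∈ V, (Finset.univ.filter fun h : H => h • A = B).card = c := by
  have hc : ∀ A ∈ V, ∀ B ∈ V, (Finset.univ.filter fun h : H => h • A = B).card =
      (Finset.univ.filter fun h : H => h • A₀ = A₀).card := by
    intro A hA B hB
    obtain ⟨a, rfl⟩ := htr A₀ hA₀ A hA
    obtain ⟨b, rfl⟩ := htr A₀ hA₀ B hB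
    refine Finset.card_bij' (fun h _ => b⁻¹ * h * a) (fun h _ => b * h * a⁻¹) ?_ ?_ ?_ ?_
    · intro h hh
      simp only [Finset.mem_filter, Finset.mem_univ, true_and] at hh ⊢
      rw [mul_assoc, mul_smul, mul_smul, hh, inv_smul_smul]
    · intro h hh
      simp only [Finset.mem_filter, Finset.mem_univ, true_and] at hh ⊢
      rw [mul_smul, mul_smul, inv_smul_smul, hh]
    · intro h _; group
    · intro h _; group
  refine ⟨_, ?_, ?_, hc⟩
  · exact Finset.card_pos.2 ⟨1, by simp⟩
  · have := Finset.card_eq_sum_card_fiberwise (s := (Finset.univ : Finset H)) (t := V)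
      (f := fun h => h • A₀) (fun h _ => hcl A₀ hA₀ h)
    rw [Finset.sum_congr rfl (fun B hB => hc A₀ hA₀ B hB)] at this
    rw [← Finset.card_univ, this]
    simp [mul_comm]

open scoped Pointwise in
lemma ekr_finite {α H : Type*} [Fintype α] [DecidableEq α] [Group H] [Fintype H] [MulAction H α]
    (n k : ℕ) (hn : 0 < n) (hcard : Fintype.card α = n) (hnk : 2 * k ≤ n)
    (V : Finset (Finset α)) (hV : ∀ A ∈ V, A.card = k)
    (htransX : ∀ x y : α, ∃ g : H, g • x = y)
    (hcl : ∀ A ∈ V, ∀ g : H, g • A ∈ V)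
    (htr : ∀ A ∈ V, ∀ B ∈ V, ∃ g : H, g • A = B)
    (x : ZMod n → α) (hx : Function.Injective x)
    (hcyc : ∀ i : ZMod n,
      (Finset.univ.image fun t : Fin k => x (i + ((t : ℕ) : ZMod n))) ∈ V)
    (B : Finset (Finset α)) (hBV : B ⊆ V)
    (hB : ∀ A ∈ B, ∀ A' ∈ B, ∃ y, y ∈ A ∧ y ∈ A') (z : α) :
    B.card ≤ (V.filter fun A => z ∈ A).card := by
  have : NeZero n := ⟨hn.ne'⟩
  obtain ⟨c, hc0, hcV, hc⟩ := count_const (H := H) V hcl htr _ (hcyc 0)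
  -- the star is as large as it should be
  have hstar : n * (V.filter fun A => z ∈ A).card = k * V.card := by
    have hconst : ∀ y : α, (V.filter fun A => y ∈ A).card = (V.filter fun A => z ∈ A).card := by
      intro y
      obtain ⟨g, rfl⟩ := htransX y z
      refine Finset.card_bij' (fun A _ => g • A) (fun A _ => g⁻¹ • A) ?_ ?_ ?_ ?_
      · intro A hA
        simp only [Finset.mem_filter] at hA ⊢
        exact ⟨hcl A hA.1 g, Finset.smul_mem_smul_finset hA.2⟩
      · intro A hA
        simp only [Finset.mem_filter] at hA ⊢
        refine ⟨hcl A hA.1 _, ?_⟩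
        simpa using Finset.smul_mem_smul_finset (a := g⁻¹) hA.2
      · intro A _; simp
      · intro A _; simp
    have h1 := Finset.sum_card_bipartiteAbove_eq_sum_card_bipartiteBelow
      (s := (Finset.univ : Finset α)) (t := V) (fun y A => y ∈ A)
    unfold Finset.bipartiteAbove Finset.bipartiteBelow at h1
    rw [Finset.sum_congr rfl (fun y _ => hconst y)] at h1
    have h2 : ∑ A ∈ V, (Finset.univ.filter fun y => y ∈ A).card = ∑ _A ∈ V, k :=
      Finset.sum_congr rfl (fun A hA => by rw [Finset.filter_univ_mem]; exact hV A hA)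
    have h3 := h1.trans h2
    simpa [hcard, mul_comm] using h3
  -- the double count of Katona
  have hkat : n * B.card * c ≤ k * Fintype.card H := by
    have h1 := Finset.sum_card_bipartiteAbove_eq_sum_card_bipartiteBelow
      (s := (Finset.univ : Finset H)) (t := (Finset.univ : Finset (ZMod n)))
      (fun h i => h • (Finset.univ.image fun t : Fin k => x (i + ((t : ℕ) : ZMod n))) ∈ B)
    unfold Finset.bipartiteAbove Finset.bipartiteBelow at h1
    have h2 : ∀ i : ZMod n, (Finset.univ.filter fun h : H =>
        h • (Finset.univ.image fun t : Fin k => x (i + ((t : ℕ) : ZMod n))) ∈ B).card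
        = B.card * c := by
      intro i
      rw [Finset.card_eq_sum_card_fiberwise (t := B)
        (f := fun h : H => h • (Finset.univ.image fun t : Fin k => x (i + ((t : ℕ) : ZMod n))))
        (fun h hh => by simpa using hh)]
      rw [Finset.sum_congr rfl (g := fun _ => c), Finset.sum_const, smul_eq_mul]
      intro A hA
      rw [← hc _ (hcyc i) A (hBV hA), Finset.filter_filter]
      congr 1
      ext h
      simp only [Finset.mem_filter, Finset.mem_univ, true_and]
      exact ⟨fun h => h.2, fun h => ⟨h ▸ hA, h⟩⟩
    have h3 : ∀ h : H, (Finset.univ.filter fun i : ZMod n =>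
        h • (Finset.univ.image fun t : Fin k => x (i + ((t : ℕ) : ZMod n))) ∈ B).card ≤ k := by
      intro h
      apply katona_aux hnk
      intro i hi j hj
      simp only [Finset.mem_filter, Finset.mem_univ, true_and] at hi hj
      obtain ⟨y, hy, hy'⟩ := hB _ hi _ hj
      obtain ⟨u, hu, rfl⟩ := Finset.mem_smul_finset.1 hy
      obtain ⟨v, hv, hvu⟩ := Finset.mem_smul_finset.1 hy'
      have : v = u := MulAction.injective h hvu
      subst this
      obtain ⟨s, _, hs⟩ := Finset.mem_image.1 hu
      obtain ⟨t, _, ht⟩ := Finset.mem_image.1 hv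
      exact ⟨s, s.2, t, t.2, hx (hs.trans ht.symm)⟩
    rw [Finset.sum_congr rfl (fun i _ => h2 i)] at h1
    have h4 := Finset.sum_le_sum (s := Finset.univ) (fun h (_ : h ∈ Finset.univ) => h3 h)
    rw [h1] at h4
    simp only [Finset.sum_const, Finset.card_univ, ZMod.card, smul_eq_mul] at h4
    linarith
  rw [← hcV] at hkat
  have h5 : (n * c) * B.card ≤ (n * c) * (V.filter fun A => z ∈ A).card := by
    calc (n * c) * B.card = n * B.card * c := by ring
      _ ≤ k * (c * V.card) := hkat
      _ = c * (k * V.card) := by ring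
      _ = _ := by rw [← hstar]; ring
  exact Nat.le_of_mul_le_mul_left h5 (by positivity)

/-- **Borg–Meagher / generalized Katona cycle method.** Let `α` be an `n`-element ground set
and `𝒱` a family of `k`-subsets of `α` with `n ≥ 2k`. If (1) a group `G` acts transitively on
`α` and the induced action on `k`-subsets preserves `𝒱` and is transitive on `𝒱`, and (2) there
is a cyclic ordering `x : ZMod n ≃ α` of the elements such that every `k` consecutive elements
form a member of `𝒱`, then `𝒱` is an EKR family. -/
theorem admissible_ordering_EKR {α : Type*} [Fintype α] [DecidableEq α]
    (n k : ℕ) (hcard : Fintype.card α = n) (hnk : 2 * k ≤ n)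
    (𝒱 : Set (Finset α)) (h𝒱 : ∀ A ∈ 𝒱, A.card = k)
    (G : Type*) [Group G] [MulAction G α]
    (htransX : ∀ x y : α, ∃ g : G, g • x = y)
    (hclosed : ∀ A ∈ 𝒱, ∀ g : G, A.image (g • ·) ∈ 𝒱)
    (htransV : ∀ A ∈ 𝒱, ∀ B ∈ 𝒱, ∃ g : G, A.image (g • ·) = B)
    (x : ZMod n → α) (hx : Function.Bijective x)
    (hcyc : ∀ i : ZMod n,
      (Finset.univ.image fun t : Fin k => x (i + ((t : ℕ) : ZMod n))) ∈ 𝒱) :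
    IsEKRFamily Set.univ 𝒱 := by
  classical
  intro z _ ℬ hℬ hint
  have hn : 0 < n := hcard ▸ Fintype.card_pos_iff.2 ⟨z⟩
  let φ := MulAction.toPermHom G α
  have : Fintype φ.range := Fintype.ofFinite _
  have := ekr_finite (H := φ.range) n k hn hcard hnk 𝒱.toFinset
    (fun A hA => h𝒱 A (by simpa using hA))
    (fun a b => by
      obtain ⟨g, hg⟩ := htransX a b
      exact ⟨⟨φ g, g, rfl⟩, hg⟩)
    (by
      rintro A hA ⟨_, g, rfl⟩
      change A.image (g • ·) ∈ _
      simpa using hclosed A (by simpa using hA) g)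
    (fun A hA B hB => by
      obtain ⟨g, hg⟩ := htransV A (by simpa using hA) B (by simpa using hB)
      exact ⟨⟨φ g, g, rfl⟩, hg⟩)
    x hx.1 (fun i => by simpa using hcyc i) ℬ.toFinset
    (by simpa using hℬ) (fun A hA A' hA' => hint A (by simpa using hA) A' (by simpa using hA')) z
  have e : famAt 𝒱 z = ((𝒱.toFinset.filter fun A => z ∈ A : Finset (Finset α)) :
      Set (Finset α)) := by
    ext A
    simp [famAt]
  rw [e, Set.ncard_coe_finset, Set.ncard_eq_toFinset_card']
  exact this
end

section
/- Let n be a positive integer. Every intersecting family of permutations of [n] has cardinality at most (n−1)!, and for every i, j ∈ [n] the family S_{i,j} = {σ ∈ S_n : σ(i) = j} is an intersecting family of permutations of cardinality (n−1)!; hence S_{i,j} is a maximum intersecting family of permutations. -/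
/-- A family of permutations of `Fin n` is intersecting if any two of its members agree at
some point. -/
def IsIntersectingPermFamily {n : ℕ} (F : Set (Equiv.Perm (Fin n))) : Prop :=
  ∀ σ ∈ F, ∀ π ∈ F, ∃ i : Fin n, σ i = π i

/-- The upper bound: distinct rotations of the family are disjoint. -/
theorem intersecting_ncard_le (n : ℕ) (hn : 0 < n) (F : Set (Equiv.Perm (Fin n)))
    (hF : IsIntersectingPermFamily F) : F.ncard ≤ (n - 1).factorial := by
  classical
  haveI : NeZero n := ⟨hn.ne'⟩
  have hinj : Function.Injective
      (fun p : F × Fin n => (p.1 : Equiv.Perm (Fin n)) * Equiv.addRight p.2) := by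
    rintro ⟨⟨σ, hσ⟩, a⟩ ⟨⟨π, hπ⟩, b⟩ h
    have h1 : ∀ x, σ (x + a) = π (x + b) := fun x => by
      simpa using congrArg (fun τ : Equiv.Perm (Fin n) => τ x) h
    obtain ⟨i, hi⟩ := hF σ hσ π hπ
    have h2 := h1 (i - b)
    rw [sub_add_cancel, ← hi] at h2
    have h3 := σ.injective h2
    have hab : a = b := by
      have h4 : i - b + a = i - b + b := by rw [h3, sub_add_cancel]
      exact add_left_cancel h4
    subst hab
    have : σ = π := by
      ext x
      have := h1 (x - a)
      rw [sub_add_cancel] at this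
      rw [this]
    subst this
    rfl
  have hc := Nat.card_le_card_of_injective _ hinj
  rw [Nat.card_prod, Nat.card_coe_set_eq, Nat.card_perm, Nat.card_fin,
    ← Nat.mul_factorial_pred hn.ne', mul_comm] at hc
  exact Nat.le_of_mul_le_mul_left hc hn

theorem star_intersecting {n : ℕ} (i j : Fin n) :
    IsIntersectingPermFamily {σ : Equiv.Perm (Fin n) | σ i = j} :=
  fun _ hσ _ hπ => ⟨i, hσ.trans hπ.symm⟩

theorem star_ncard (n : ℕ) (hn : 0 < n) (i j : Fin n) :
    {σ : Equiv.Perm (Fin n) | σ i = j}.ncard = (n - 1).factorial := by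
  classical
  have hle : ∀ k ∈ (Finset.univ : Finset (Fin n)),
      {σ : Equiv.Perm (Fin n) | σ i = k}.ncard ≤ (n - 1).factorial := fun k _ =>
    intersecting_ncard_le n hn _ (star_intersecting i k)
  have hsum : ∑ k : Fin n, {σ : Equiv.Perm (Fin n) | σ i = k}.ncard
      = ∑ _k : Fin n, (n - 1).factorial := by
    have h := Finset.card_eq_sum_card_fiberwise
      (s := (Finset.univ : Finset (Equiv.Perm (Fin n)))) (t := Finset.univ)
      (f := fun σ => σ i) (fun _ _ => by simp)
    rw [Finset.card_univ, Fintype.card_perm, Fintype.card_fin] at h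
    rw [Finset.sum_const, Finset.card_univ, Fintype.card_fin, smul_eq_mul,
      Nat.mul_factorial_pred hn.ne', h]
    refine Finset.sum_congr rfl fun k _ => ?_
    rw [← Set.ncard_coe_finset]
    simp
  exact (Finset.sum_eq_sum_iff_of_le hle).1 hsum j (Finset.mem_univ j)

/-- **Frankl–Deza.** For every positive integer `n`, every intersecting family of permutations
of `[n]` has cardinality at most `(n-1)!`, and for every `i, j` the family
`S_{i,j} = {σ : σ i = j}` is an intersecting family of cardinality `(n-1)!`; hence `S_{i,j}`
is a maximum intersecting family of permutations. -/
theorem frankl_deza_permutations (n : ℕ) (hn : 0 < n) :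
    (∀ F : Set (Equiv.Perm (Fin n)), IsIntersectingPermFamily F →
      F.ncard ≤ (n - 1).factorial) ∧
    (∀ i j : Fin n,
      IsIntersectingPermFamily {σ : Equiv.Perm (Fin n) | σ i = j} ∧
      {σ : Equiv.Perm (Fin n) | σ i = j}.ncard = (n - 1).factorial) := by
  exact ⟨intersecting_ncard_le n hn, fun i j => ⟨star_intersecting i j, star_ncard n hn i j⟩⟩
end
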